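/- Let (X, μ) be a measure space and f a measurable function on X. For every t > 0 with f*(t) < ∞, ∫₀^t f*(s) ds = t f*(t) + ∫_{f*(t)}^∞ λ_f(s) ds. -/

import Mathlib

open MeasureTheory Set
open scoped ENNReal

/-- Distribution function: `μ {x : |f x| > s}`. -/
noncomputable def distrib {X : Type*} [MeasurableSpace X] (μ : Measure X)
    (f : X → ℝ) (s : ℝ) : ℝ≥0∞ :=
  μ {x | s < |f x|}

/-- Decreasing rearrangement: `f*(t) = inf {s > 0 : λ_f(s) ≤ t}`. -/
noncomputable def rearr {X : Type*} [MeasurableSpace X] (μ : Measure X)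
    (f : X → ℝ) (t : ℝ) : ℝ≥0∞ :=
  ⨅ (s : ℝ) (_ : 0 < s ∧ distrib μ f s ≤ ENNReal.ofReal t), ENNReal.ofReal s

/-- Maximal function `f**(t) = (1/t) ∫₀ᵗ f*(u) du`. -/
noncomputable def maxFn {X : Type*} [MeasurableSpace X] (μ : Measure X)
    (f : X → ℝ) (t : ℝ) : ℝ≥0∞ :=
  (ENNReal.ofReal t)⁻¹ * ∫⁻ u in Set.Ioc (0:ℝ) t, rearr μ f u

/-- Lorentz norm `‖f‖_{p,q}`; for `q = ∞` it is `sup_{t>0} t^{1/p} f**(t)`. -/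
noncomputable def lorentzNorm {X : Type*} [MeasurableSpace X] (μ : Measure X)
    (f : X → ℝ) (p : ℝ) (q : ℝ≥0∞) : ℝ≥0∞ :=
  if q = ⊤ then ⨆ (t : ℝ) (_ : 0 < t), ENNReal.ofReal t ^ (1/p) * maxFn μ f t
  else (∫⁻ t in Set.Ioi (0:ℝ),
      (ENNReal.ofReal t ^ (1/p) * maxFn μ f t) ^ q.toReal * (ENNReal.ofReal t)⁻¹) ^ (1 / q.toReal)

/-- Convolution on ℝⁿ: `(f ∗ g)(x) = ∫ f(x-y) g(y) dy`. -/
noncomputable def conv {n : ℕ} (f g : EuclideanSpace ℝ (Fin n) → ℝ)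
    (x : EuclideanSpace ℝ (Fin n)) : ℝ :=
  ∫ y, f (x - y) * g y

/-- `‖f‖_p = (∫ |f|^p dμ)^{1/p}`. -/
noncomputable def lpNorm {X : Type*} [MeasurableSpace X] (μ : Measure X)
    (f : X → ℝ) (p : ℝ) : ℝ≥0∞ :=
  (∫⁻ x, ENNReal.ofReal |f x| ^ p ∂μ) ^ (1/p)

/-- Riesz potential `I_α f(x) = ∫ |x-y|^{α-n} f(y) dy` on ℝⁿ. -/
noncomputable def riesz (n : ℕ) (α : ℝ) (f : EuclideanSpace ℝ (Fin n) → ℝ)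
    (x : EuclideanSpace ℝ (Fin n)) : ℝ :=
  ∫ y, ‖x - y‖ ^ (α - (n:ℝ)) * f y

lemma distrib_antitone {X : Type*} [MeasurableSpace X] (μ : Measure X) (f : X → ℝ) :
    Antitone (distrib μ f) :=
  fun _ _ hab ↦ measure_mono fun _ hx ↦ lt_of_le_of_lt hab hx

lemma distrib_le_of_forall_gt {X : Type*} [MeasurableSpace X] {μ : Measure X} {f : X → ℝ}
    {u : ℝ} {c : ℝ≥0∞} (h : ∀ v, u < v → distrib μ f v ≤ c) : distrib μ f u ≤ c := by
  have hU : {x | u < |f x|} = ⋃ n : ℕ, {x | u + 1 / ((n : ℝ) + 1) < |f x|} := by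
    ext x
    simp only [mem_ofPred_eq, mem_iUnion]
    constructor
    · intro hx
      obtain ⟨n, hn⟩ := exists_nat_one_div_lt (sub_pos.2 hx)
      exact ⟨n, by linarith⟩
    · rintro ⟨n, hn⟩
      have : 0 < 1 / ((n : ℝ) + 1) := Nat.one_div_pos_of_nat
      linarith
  have hmono : Monotone fun n : ℕ ↦ {x | u + 1 / ((n : ℝ) + 1) < |f x|} := by
    intro m n hmn x hx
    have : 1 / ((n : ℝ) + 1) ≤ 1 / ((m : ℝ) + 1) := Nat.one_div_le_one_div hmn
    simp only [mem_ofPred_eq] at hx ⊢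
    linarith
  rw [distrib, hU, hmono.measure_iUnion]
  exact iSup_le fun n ↦ h _ (lt_add_of_pos_right u Nat.one_div_pos_of_nat)

/-- The distribution function and the decreasing rearrangement are generalized inverses. -/
lemma rearr_le_ofReal_iff {X : Type*} [MeasurableSpace X] {μ : Measure X} {f : X → ℝ}
    {s u : ℝ} (hu : 0 < u) :
    rearr μ f s ≤ ENNReal.ofReal u ↔ distrib μ f u ≤ ENNReal.ofReal s := by
  constructor
  · intro h
    refine distrib_le_of_forall_gt fun v huv ↦ ?_
    have hlt : rearr μ f s < ENNReal.ofReal v :=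
      h.trans_lt ((ENNReal.ofReal_lt_ofReal_iff (hu.trans huv)).2 huv)
    simp only [rearr, iInf_lt_iff] at hlt
    obtain ⟨w, ⟨_, hw⟩, hwv⟩ := hlt
    exact (distrib_antitone μ f (ENNReal.ofReal_lt_ofReal_iff (hu.trans huv) |>.1 hwv).le).trans hw
  · intro h
    exact iInf₂_le u ⟨hu, h⟩

lemma volume_Ioi_zero_inter_ofReal_lt (c : ℝ≥0∞) :
    volume (Ioi (0 : ℝ) ∩ {u | ENNReal.ofReal u < c}) = c := by
  induction c with
  | top => simp
  | coe c =>
    have : Ioi (0 : ℝ) ∩ {u | ENNReal.ofReal u < c} = Ioo 0 (c : ℝ) := by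
      ext u
      simp only [mem_inter_iff, mem_Ioi, mem_ofPred_eq, mem_Ioo, and_congr_right_iff]
      intro hu
      rw [ENNReal.ofReal_lt_iff_lt_toReal hu.le ENNReal.coe_ne_top, ENNReal.coe_toReal]
    simp [this]

lemma volume_Ioc_zero_inter_ofReal_lt_of_le {t : ℝ} {c : ℝ≥0∞} (hc : c ≤ ENNReal.ofReal t) :
    volume (Ioc 0 t ∩ {u | ENNReal.ofReal u < c}) = c := by
  refine Eq.trans (congrArg volume ?_) (volume_Ioi_zero_inter_ofReal_lt c)
  ext u
  simp only [mem_inter_iff, mem_Ioc, mem_ofPred_eq, mem_Ioi]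
  refine ⟨fun h ↦ ⟨h.1.1, h.2⟩, fun h ↦ ⟨⟨h.1, ?_⟩, h.2⟩⟩
  exact (ENNReal.ofReal_lt_ofReal_iff'.1 (h.2.trans_le hc)).1.le

lemma volume_Ioc_zero_inter_ofReal_lt_of_gt {t : ℝ} {c : ℝ≥0∞} (hc : ENNReal.ofReal t < c) :
    volume (Ioc 0 t ∩ {u | ENNReal.ofReal u < c}) = ENNReal.ofReal t := by
  have hsub : Ioc 0 t ⊆ {u | ENNReal.ofReal u < c} :=
    fun u hu ↦ (ENNReal.ofReal_le_ofReal hu.2).trans_lt hc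
  simp [inter_eq_left.2 hsub]

/-- The layer-cake form of `∫₀ᵗ f*(s) ds`, obtained by computing the area under `f*` along
horizontal slices. -/
lemma lintegral_rearr_eq_lintegral_volume {X : Type*} [MeasurableSpace X] (μ : Measure X)
    (f : X → ℝ) (t : ℝ) :
    ∫⁻ s in Ioc (0 : ℝ) t, rearr μ f s
      = ∫⁻ u in Ioi (0 : ℝ), volume (Ioc 0 t ∩ {s | ENNReal.ofReal s < distrib μ f u}) := by
  set R : Set (ℝ × ℝ) := {p | ENNReal.ofReal p.1 < distrib μ f p.2}
  have hR : MeasurableSet R := measurableSet_lt (ENNReal.measurable_ofReal.comp measurable_fst)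
    ((distrib_antitone μ f).measurable.comp measurable_snd)
  have hvert (s : ℝ) :
      rearr μ f s = (volume.restrict (Ioi (0 : ℝ))) (Prod.mk s ⁻¹' R) := by
    rw [Measure.restrict_apply (measurable_prodMk_left hR), inter_comm,
      ← volume_Ioi_zero_inter_ofReal_lt (rearr μ f s)]
    congr 1
    ext u
    simp only [mem_inter_iff, mem_Ioi, mem_ofPred_eq, mem_preimage, R, and_congr_right_iff]
    intro hu
    rw [← not_le, ← not_le, rearr_le_ofReal_iff hu]
  simp_rw [hvert]
  rw [← Measure.prod_apply hR, Measure.prod_apply_symm hR]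
  refine lintegral_congr fun u ↦ ?_
  rw [Measure.restrict_apply (measurable_prodMk_right hR), inter_comm]
  rfl

/-- For every `t > 0` with `f*(t) < ∞`,
`∫₀^t f*(s) ds = t f*(t) + ∫_{f*(t)}^∞ λ_f(s) ds`. -/
theorem integral_rearr_eq {X : Type*} [MeasurableSpace X] (μ : Measure X)
    (f : X → ℝ) (hf : Measurable f)
    (t : ℝ) (ht : 0 < t) (hft : rearr μ f t < ⊤) :
    ∫⁻ s in Set.Ioc (0:ℝ) t, rearr μ f s
      = ENNReal.ofReal t * rearr μ f t
        + ∫⁻ s in Set.Ioi ((rearr μ f t).toReal), distrib μ f s := by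
  rw [lintegral_rearr_eq_lintegral_volume]
  set a : ℝ := (rearr μ f t).toReal
  have ha : rearr μ f t = ENNReal.ofReal a := (ENNReal.ofReal_toReal hft.ne).symm
  have ha0 : 0 ≤ a := ENNReal.toReal_nonneg
  rw [← Ioc_union_Ioi_eq_Ioi ha0,
    lintegral_union measurableSet_Ioi (Ioc_disjoint_Ioi le_rfl),
    setLIntegral_congr Ioo_ae_eq_Ioc.symm]
  congr 1
  · have hlow : ∀ u ∈ Ioo 0 a, volume (Ioc 0 t ∩ {s | ENNReal.ofReal s < distrib μ f u})
        = ENNReal.ofReal t := by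
      intro u hu
      refine volume_Ioc_zero_inter_ofReal_lt_of_gt ?_
      rw [← not_le, ← rearr_le_ofReal_iff hu.1, not_le, ha]
      exact (ENNReal.ofReal_lt_ofReal_iff (hu.1.trans hu.2)).2 hu.2
    rw [setLIntegral_congr_fun measurableSet_Ioo hlow, ha]
    simp
  · refine setLIntegral_congr_fun measurableSet_Ioi fun u hu ↦ ?_
    refine volume_Ioc_zero_inter_ofReal_lt_of_le ?_
    rw [← rearr_le_ofReal_iff (ha0.trans_lt hu), ha]
    exact ENNReal.ofReal_le_ofReal (le_of_lt hu)
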